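/- arXiv:2512.06137 — 3 statements merged into one kernel-verified Lean document; each statement's English description precedes it below -/
import Mathlib

section
/- For every integer N > 2 and all a, b > 0 with a ≠ b, the symmetric 2×2 matrix B with B₁₁ = q_N(a,b), B₂₂ = q_N(b,a), and B₁₂ = B₂₁ = p_N(a,b) is negative definite (its trace is negative and its determinant q_N(a,b)·q_N(b,a) − p_N(a,b)² is positive). -/
open Real Matrix

/-- `p_N(a,b) = 2ab/(a² − b²)² − 2 a^{2/N−1} b^{2/N−1}/(N(a^{2/N} − b^{2/N}))²`. -/
noncomputable def pN (N : ℕ) (a b : ℝ) : ℝ :=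
  2*a*b/(a^2 - b^2)^2
    - 2 * a^((2:ℝ)/N - 1) * b^((2:ℝ)/N - 1) / ((N:ℝ) * (a^((2:ℝ)/N) - b^((2:ℝ)/N)))^2

/-- `q_N(a,b) = −(a² + b²)/(a² − b²)² + a^{2/N−2}(N(a^{2/N} − b^{2/N}) + 2b^{2/N})/(N(a^{2/N} − b^{2/N}))²`. -/
noncomputable def qN (N : ℕ) (a b : ℝ) : ℝ :=
  -(a^2 + b^2)/(a^2 - b^2)^2
    + a^((2:ℝ)/N - 2) * ((N:ℝ) * (a^((2:ℝ)/N) - b^((2:ℝ)/N)) + 2 * b^((2:ℝ)/N))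
      / ((N:ℝ) * (a^((2:ℝ)/N) - b^((2:ℝ)/N)))^2

/-- The `2×2` block `[[q_N(a,b), p_N(a,b)], [p_N(a,b), q_N(b,a)]]`. -/
noncomputable def Bmat (N : ℕ) (a b : ℝ) : Matrix (Fin 2) (Fin 2) ℝ :=
  !![qN N a b, pN N a b; pN N a b, qN N b a]

theorem sinh_mul_lt_mul_sinh {k m : ℝ} (hk0 : 0 < k) (hk1 : k < 1) (hm : 0 < m) :
    sinh (k * m) < k * sinh m := by
  have hmono : StrictMonoOn (fun t => k * sinh t - sinh (k * t)) (Set.Ici 0) := by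
    apply strictMonoOn_of_hasDerivWithinAt_pos (convex_Ici 0)
      (f' := fun t => k * cosh t - cosh (k * t) * (k * 1))
    · fun_prop
    · intro t _
      exact (((hasDerivAt_sinh t).const_mul k).sub
        (((hasDerivAt_id t).const_mul k).sinh)).hasDerivWithinAt
    · intro t ht
      rw [interior_Ici] at ht
      have ht : 0 < t := ht
      have : cosh (k * t) < cosh t := by
        rw [cosh_lt_cosh, abs_of_pos (by positivity), abs_of_pos ht]
        nlinarith
      nlinarith
  have := hmono (Set.mem_Ici.2 le_rfl) (Set.mem_Ici.2 hm.le) hm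
  simp at this
  linarith

theorem sinh_one_sub_mul_lt {c t : ℝ} (hc0 : 0 < c) (hc : c < 1 / 2) (ht : 0 < t) :
    sinh ((1 - c) * t) < (1 - 2 * c) * sinh t + sinh (c * t) := by
  have h := sinh_mul_lt_mul_sinh (k := 1 - 2 * c) (m := t / 2)
    (by linarith) (by linarith) (by linarith)
  have e1 : (1 - c) * t = t / 2 + (1 - 2 * c) * (t / 2) := by ring
  have e2 : c * t = t / 2 - (1 - 2 * c) * (t / 2) := by ring
  have e3 : sinh t = 2 * sinh (t / 2) * cosh (t / 2) := by
    rw [← sinh_two_mul]; congr 1; ring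
  rw [e1, e2, e3, sinh_add, sinh_sub]
  nlinarith [cosh_pos (t / 2)]

theorem lt_cosh_combination {c t : ℝ} (hc0 : 0 < c) (hc : c < 1 / 2) (ht : t ≠ 0) :
    2 - 2 * c - 6 * c ^ 2 + 4 * c ^ 3 <
      2 * c * (1 - c) * (1 - 2 * c) * cosh t + 2 * (1 - c) * cosh (c * t)
        - 2 * c * cosh ((1 - c) * t) := by
  wlog hpos : 0 < t generalizing t
  · have := this (t := -t) (neg_ne_zero.2 ht)
      (neg_pos.2 (lt_of_le_of_ne (not_lt.1 hpos) ht))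
    simpa only [mul_neg, cosh_neg] using this
  have hmono : StrictMonoOn (fun t => 2 * c * (1 - c) * (1 - 2 * c) * cosh t
      + 2 * (1 - c) * cosh (c * t) - 2 * c * cosh ((1 - c) * t)) (Set.Ici 0) := by
    apply strictMonoOn_of_hasDerivWithinAt_pos (convex_Ici 0)
      (f' := fun t => 2 * c * (1 - c) * (1 - 2 * c) * sinh t
        + 2 * (1 - c) * (sinh (c * t) * (c * 1))
        - 2 * c * (sinh ((1 - c) * t) * ((1 - c) * 1)))
    · fun_prop
    · intro t _
      exact ((((hasDerivAt_cosh t).const_mul _).add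
        ((((hasDerivAt_id t).const_mul c).cosh).const_mul _)).sub
        ((((hasDerivAt_id t).const_mul (1 - c)).cosh).const_mul _)).hasDerivWithinAt
    · intro t ht
      rw [interior_Ici] at ht
      have h := sinh_one_sub_mul_lt hc0 hc ht
      have h1 : 0 < c * (1 - c) := mul_pos hc0 (by linarith)
      nlinarith
  have := hmono (Set.mem_Ici.2 le_rfl) (Set.mem_Ici.2 hpos.le) hpos
  simp at this
  linarith

theorem cosh_log_sub_log {u v : ℝ} (hu : 0 < u) (hv : 0 < v) :
    cosh (log u - log v) = (u ^ 2 + v ^ 2) / (2 * u * v) := by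
  rw [cosh_eq, neg_sub, exp_sub, exp_sub, exp_log hu, exp_log hv]
  field_simp

theorem rpow_polynomial_pos {c a b : ℝ} (hc0 : 0 < c) (hc : c < 1 / 2)
    (ha : 0 < a) (hb : 0 < b) (hab : a ≠ b) :
    0 < c * (1 - c) * (1 - 2 * c) * (a ^ 4 + b ^ 4) * (a ^ (2 * c) * b ^ (2 * c))
      + (1 - c) * ((a ^ (2 * c)) ^ 2 + (b ^ (2 * c)) ^ 2) * (a ^ 2 * b ^ 2)
      - c * (a ^ 4 * (b ^ (2 * c)) ^ 2 + b ^ 4 * (a ^ (2 * c)) ^ 2)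
      - (2 - 2 * c - 6 * c ^ 2 + 4 * c ^ 3)
        * (a ^ 2 * b ^ 2 * (a ^ (2 * c) * b ^ (2 * c))) := by
  have hX : 0 < a ^ (2 * c) := rpow_pos_of_pos ha _
  have hY : 0 < b ^ (2 * c) := rpow_pos_of_pos hb _
  have hlX : log (a ^ (2 * c)) = 2 * c * log a := log_rpow ha _
  have hlY : log (b ^ (2 * c)) = 2 * c * log b := log_rpow hb _
  have hne : log (a ^ 2) - log (b ^ 2) ≠ 0 := by
    rw [log_pow, log_pow, ← mul_sub]
    refine mul_ne_zero (by norm_num) (sub_ne_zero.2 fun h => hab ?_)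
    exact log_injOn_pos ha hb h
  have h := lt_cosh_combination hc0 hc hne
  have e2 : c * (log (a ^ 2) - log (b ^ 2)) = log (a ^ (2 * c)) - log (b ^ (2 * c)) := by
    rw [hlX, hlY, log_pow, log_pow]; push_cast; ring
  have e3 : (1 - c) * (log (a ^ 2) - log (b ^ 2))
      = log (a ^ 2 * b ^ (2 * c)) - log (b ^ 2 * a ^ (2 * c)) := by
    rw [log_mul (by positivity) hY.ne', log_mul (by positivity) hX.ne', hlX, hlY,
      log_pow, log_pow]
    push_cast; ring
  rw [e2, e3, cosh_log_sub_log (by positivity) (by positivity), cosh_log_sub_log hX hY,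
    cosh_log_sub_log (by positivity) (by positivity)] at h
  generalize a ^ (2 * c) = X at *
  generalize b ^ (2 * c) = Y at *
  have hmul := mul_pos (sub_pos.2 h) (show 0 < a ^ 2 * b ^ 2 * (X * Y) by positivity)
  refine hmul.trans_eq ?_
  field_simp

theorem neg_of_det_pos_of_form_neg {q₁ q₂ p a b : ℝ} (hb : 0 < b)
    (hdet : 0 < q₁ * q₂ - p ^ 2)
    (hform : a ^ 2 * q₁ + b ^ 2 * q₂ + 2 * (a * b) * p < 0) : q₁ < 0 ∧ q₂ < 0 := by
  have hq₁ : q₁ < 0 := by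
    by_contra! h
    nlinarith [mul_nonneg h (neg_nonneg.2 hform.le), sq_nonneg (a * q₁ + b * p),
      mul_pos (pow_pos hb 2) hdet]
  refine ⟨hq₁, ?_⟩
  by_contra! h
  nlinarith [sq_nonneg p]

theorem form_neg_of_det_pos {q₁ q₂ p y z : ℝ} (hq₁ : q₁ < 0) (hdet : 0 < q₁ * q₂ - p ^ 2)
    (hyz : y ≠ 0 ∨ z ≠ 0) : q₁ * y ^ 2 + 2 * p * (y * z) + q₂ * z ^ 2 < 0 := by
  have hpos : 0 < (q₁ * y + p * z) ^ 2 + (q₁ * q₂ - p ^ 2) * z ^ 2 := by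
    by_cases hz : z = 0
    · have hy : y ≠ 0 := hyz.resolve_right (not_not.2 hz)
      have : q₁ * y ≠ 0 := mul_ne_zero hq₁.ne hy
      simp only [hz, mul_zero, add_zero]
      positivity
    · positivity
  by_contra! h
  nlinarith [mul_nonneg (neg_nonneg.2 hq₁.le) h]

theorem pN_eq {N : ℕ} {a b : ℝ} (ha : 0 < a) (hb : 0 < b) :
    pN N a b = 2 * a * b / (a ^ 2 - b ^ 2) ^ 2
      - 2 * (a ^ (2 * (1 / (N : ℝ))) / a) * (b ^ (2 * (1 / (N : ℝ))) / b)
        / ((N : ℝ) * (a ^ (2 * (1 / (N : ℝ))) - b ^ (2 * (1 / (N : ℝ))))) ^ 2 := by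
  rw [pN, rpow_sub_one ha.ne', rpow_sub_one hb.ne', mul_one_div]

theorem qN_eq {N : ℕ} {a b : ℝ} (ha : 0 < a) :
    qN N a b = -(a ^ 2 + b ^ 2) / (a ^ 2 - b ^ 2) ^ 2
      + a ^ (2 * (1 / (N : ℝ))) / a ^ 2
        * ((N : ℝ) * (a ^ (2 * (1 / (N : ℝ))) - b ^ (2 * (1 / (N : ℝ))))
          + 2 * b ^ (2 * (1 / (N : ℝ))))
        / ((N : ℝ) * (a ^ (2 * (1 / (N : ℝ))) - b ^ (2 * (1 / (N : ℝ))))) ^ 2 := by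
  rw [qN, rpow_sub ha, rpow_two, mul_one_div]

theorem rpow_two_mul_ne {c a b : ℝ} (hc0 : 0 < c) (ha : 0 < a) (hb : 0 < b)
    (hab : a ≠ b) : a ^ (2 * c) - b ^ (2 * c) ≠ 0 :=
  sub_ne_zero.2 fun h => hab ((rpow_left_inj ha.le hb.le (by positivity)).1 h)

theorem sq_sub_sq_ne {a b : ℝ} (ha : 0 < a) (hb : 0 < b) (hab : a ≠ b) :
    a ^ 2 - b ^ 2 ≠ 0 :=
  sub_ne_zero.2 fun h => hab ((pow_left_inj₀ ha.le hb.le two_ne_zero).1 h)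

theorem Bmat_form_eq {N : ℕ} (hN : 2 < N) {a b : ℝ} (ha : 0 < a) (hb : 0 < b)
    (hab : a ≠ b) :
    a ^ 2 * qN N a b + b ^ 2 * qN N b a + 2 * (a * b) * pN N a b = 1 / (N : ℝ) - 1 := by
  have hN0 : 0 < (N : ℝ) := by positivity
  have hXY := rpow_two_mul_ne (one_div_pos.2 hN0) ha hb hab
  have hYX := rpow_two_mul_ne (one_div_pos.2 hN0) hb ha hab.symm
  have hxy := sq_sub_sq_ne ha hb hab
  have hyx := sq_sub_sq_ne hb ha hab.symm
  rw [qN_eq ha, qN_eq hb, pN_eq ha hb]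
  generalize a ^ (2 * (1 / (N : ℝ))) = X at *
  generalize b ^ (2 * (1 / (N : ℝ))) = Y at *
  rw [← neg_sub X Y, ← neg_sub (a ^ 2) (b ^ 2), mul_neg, neg_sq, neg_sq]
  field_simp
  ring

theorem Bmat_det_pos {N : ℕ} (hN : 2 < N) {a b : ℝ} (ha : 0 < a) (hb : 0 < b)
    (hab : a ≠ b) : 0 < qN N a b * qN N b a - pN N a b ^ 2 := by
  have hN2 : (2 : ℝ) < N := by exact_mod_cast hN
  have hN0 : 0 < (N : ℝ) := by positivity
  have hpoly := rpow_polynomial_pos (one_div_pos.2 hN0)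
    (one_div_lt_one_div_of_lt two_pos hN2) ha hb hab
  have hXY := rpow_two_mul_ne (one_div_pos.2 hN0) ha hb hab
  have hxy := sq_sub_sq_ne ha hb hab
  rw [qN_eq ha, qN_eq hb, pN_eq ha hb]
  generalize a ^ (2 * (1 / (N : ℝ))) = X at *
  generalize b ^ (2 * (1 / (N : ℝ))) = Y at *
  rw [← neg_sub X Y, ← neg_sub (a ^ 2) (b ^ 2), mul_neg, neg_sq, neg_sq]
  have hden : 0 < (a ^ 2 - b ^ 2) ^ 2 * (X - Y) ^ 2 * (a * b) ^ 2 := by positivity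
  refine (div_pos hpoly hden).trans_eq ?_
  field_simp
  ring

/-- For `N > 2` and `a ≠ b` positive, the symmetric block `B` is negative definite:
its trace is negative, its determinant `q_N(a,b)q_N(b,a) − p_N(a,b)²` is positive,
and its quadratic form is negative on nonzero vectors. -/
theorem stmt7 (N : ℕ) (hN : 2 < N) (a b : ℝ) (ha : 0 < a) (hb : 0 < b)
    (hab : a ≠ b) :
    (Bmat N a b).trace < 0 ∧
    0 < qN N a b * qN N b a - pN N a b ^ 2 ∧
    (∀ x : Fin 2 → ℝ, x ≠ 0 → x ⬝ᵥ (Bmat N a b *ᵥ x) < 0) := by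
  have hdet := Bmat_det_pos hN ha hb hab
  have hform := Bmat_form_eq hN ha hb hab
  have hN1 : 1 / (N : ℝ) < 1 := by
    rw [div_lt_one (by positivity)]
    exact_mod_cast (by omega : 1 < N)
  obtain ⟨hq₁, hq₂⟩ := neg_of_det_pos_of_form_neg (a := a) hb hdet (by linarith)
  refine ⟨?_, hdet, fun x hx => ?_⟩
  · simp only [Bmat, trace_fin_two_of]
    linarith
  · have hx' : x 0 ≠ 0 ∨ x 1 ≠ 0 := by
      by_contra! h
      exact hx (funext fun i => by fin_cases i <;> simp [h.1, h.2])
    have := form_neg_of_det_pos hq₁ hdet hx'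
    simp only [Bmat, vec2_dotProduct, mulVec, of_apply, cons_val_zero, cons_val_one]
    linarith
end

section
/- Let N ≥ 2, d ≥ 2 be integers, β > 0, let g : ℝ → ℝ be differentiable with g' > 0 everywhere, and let f : (0,∞) → ℝ be differentiable and strictly convex. Suppose σ ∈ ℝ^d with σ_1 ≥ σ_2 ≥ ⋯ ≥ σ_d > 0 satisfies the stationarity equations g'(Σ_{k=1}^d f(σ_k))·f'(σ_i) = β⁻¹ Σ_{k≠i} r_N(σ_i, σ_k) for every i = 1,…,d. Then σ_1 = σ_2 = ⋯ = σ_d, and the common value σ⋆ satisfies the balance equation g'(d·f(σ⋆))·f'(σ⋆) = β⁻¹·((d−1)/(2σ⋆))·(1 − 1/N). -/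
open Real Finset

/-- `r_N(a,b) = a/(a² − b²) − a^{2/N−1}/(N(a^{2/N} − b^{2/N}))` off the diagonal,
with diagonal value `(1/(2a))(1 − 1/N)`. -/
noncomputable def rN (N : ℕ) (a b : ℝ) : ℝ :=
  if a = b then (1/(2*a)) * (1 - 1/(N:ℝ))
  else a/(a^2 - b^2) - a^((2:ℝ)/N - 1)/((N:ℝ) * (a^((2:ℝ)/N) - b^((2:ℝ)/N)))

/-- The geometric sum `1 + X + ⋯ + X^(n-1)`. -/
noncomputable def geomPoly (n : ℕ) : Polynomial ℝ := ∑ i ∈ range n, Polynomial.X ^ i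

section geomPoly

open Polynomial

lemma geomPoly_succ (n : ℕ) : geomPoly (n + 1) = geomPoly n + X ^ n :=
  sum_range_succ _ _

lemma geomPoly_succ' (n : ℕ) : geomPoly (n + 1) = 1 + X * geomPoly n := by
  rw [geomPoly, geom_sum_succ, geomPoly, add_comm]

lemma geomPoly_mul_X_sub_one (n : ℕ) : geomPoly n * (X - 1) = X ^ n - 1 :=
  geom_sum_mul _ _

lemma eval_geomPoly_nonneg (n : ℕ) {x : ℝ} (hx : 0 ≤ x) : 0 ≤ (geomPoly n).eval x := by
  rw [geomPoly, eval_finsetSum]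
  exact sum_nonneg fun i _ => by rw [eval_pow, eval_X]; positivity

lemma eval_geomPoly_pos {n : ℕ} (hn : 1 ≤ n) {x : ℝ} (hx : 0 ≤ x) :
    0 < (geomPoly n).eval x := by
  obtain ⟨m, rfl⟩ := Nat.exists_eq_add_of_le' hn
  have := mul_nonneg hx (eval_geomPoly_nonneg m hx)
  simp only [geomPoly_succ', eval_add, eval_one, eval_mul, eval_X]
  linarith

lemma eval_derivative_geomPoly_nonneg (n : ℕ) {x : ℝ} (hx : 0 ≤ x) :
    0 ≤ (geomPoly n).derivative.eval x := by
  rw [geomPoly, derivative_sum, eval_finsetSum]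
  refine sum_nonneg fun i _ => ?_
  simp only [derivative_X_pow, eval_mul, eval_C, eval_pow, eval_X]
  positivity

lemma eval_geomPoly_one (n : ℕ) : (geomPoly n).eval 1 = n := by
  simp [geomPoly, eval_finsetSum]

lemma eval_derivative_geomPoly_one (n : ℕ) :
    (geomPoly n).derivative.eval 1 = (n : ℝ) * (n - 1) / 2 := by
  induction n with
  | zero => simp [geomPoly]
  | succ n ih =>
    simp only [geomPoly_succ, derivative_add, derivative_X_pow, eval_add, ih, eval_mul, eval_C,
      eval_pow, eval_X, one_pow]
    push_cast
    ring

lemma eval_derivative_two_X_mul_geomPoly_le (n : ℕ) {x : ℝ} (hx : 0 ≤ x) :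
    2 * (geomPoly n).derivative.eval x + x * (geomPoly n).derivative.derivative.eval x ≤
      2 * (geomPoly n).eval x *
        ((geomPoly n).eval x + x * (geomPoly n).derivative.eval x) := by
  induction n with
  | zero => simp [geomPoly]
  | succ n ih =>
    have h0 : (geomPoly n).eval x ≤ 1 + x * (geomPoly n).eval x := by
      have h := congrArg (eval x) ((geomPoly_succ n).symm.trans (geomPoly_succ' n))
      simp only [eval_add, eval_pow, eval_X, eval_one, eval_mul] at h
      have : 0 ≤ x ^ n := by positivity
      linarith
    have h1 : (geomPoly n).derivative.eval x ≤
        (geomPoly n).eval x + x * (geomPoly n).derivative.eval x := by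
      have h := congrArg (fun p => eval x (derivative p))
        ((geomPoly_succ n).symm.trans (geomPoly_succ' n))
      simp only [derivative_add, derivative_X_pow, derivative_mul, derivative_one, derivative_X,
        eval_add, eval_pow, eval_X, eval_one, eval_mul, eval_C, eval_zero] at h
      have : 0 ≤ (n : ℝ) * x ^ (n - 1) := by positivity
      linarith
    have hg := eval_geomPoly_nonneg n hx
    have hg' := eval_derivative_geomPoly_nonneg n hx
    simp only [geomPoly_succ', derivative_add, derivative_mul, derivative_one, derivative_X,
      eval_add, eval_X, eval_one, eval_mul, derivative_zero, eval_zero]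
    generalize (geomPoly n).derivative.derivative.eval x = c at *
    generalize (geomPoly n).derivative.eval x = b at *
    generalize (geomPoly n).eval x = a at *
    have h2 : 0 ≤ (1 + x * a) * (1 + x * a + x * (a + x * b) - (a + x * b)) :=
      mul_nonneg (by positivity) (by nlinarith [mul_nonneg hx (sub_nonneg.2 h1)])
    nlinarith [mul_le_mul_of_nonneg_left ih (mul_nonneg hx hx),
      mul_le_mul_of_nonneg_left ih hx]

/-- The differential inequality expressing convexity of `1 / (1 + x + ⋯ + x^(n-1))`. -/
lemma eval_geomPoly_mul_derivative_two_le (n : ℕ) {x : ℝ} (hx : 0 ≤ x) :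
    (geomPoly n).eval x * (geomPoly n).derivative.derivative.eval x ≤
      2 * (geomPoly n).derivative.eval x ^ 2 := by
  induction n with
  | zero => simp [geomPoly]
  | succ n ih =>
    have h := eval_derivative_two_X_mul_geomPoly_le n hx
    simp only [geomPoly_succ', derivative_add, derivative_mul, derivative_one, derivative_X,
      eval_add, eval_X, eval_one, eval_mul, derivative_zero, eval_zero]
    nlinarith [mul_le_mul_of_nonneg_left ih (mul_nonneg hx hx)]

lemma antitoneOn_derivative_div_geomPoly_sq {n : ℕ} (hn : 1 ≤ n) :
    AntitoneOn (fun x : ℝ => (geomPoly n).derivative.eval x / (geomPoly n).eval x ^ 2)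
      (Set.Ioi 0) := by
  have hd : ∀ x ∈ Set.Ioi (0 : ℝ), HasDerivAt
      (fun x : ℝ => (geomPoly n).derivative.eval x / (geomPoly n).eval x ^ 2) _ x := fun x hx =>
    ((geomPoly n).derivative.hasDerivAt x).div (((geomPoly n).hasDerivAt x).pow 2)
      (pow_ne_zero 2 (eval_geomPoly_pos hn (le_of_lt hx)).ne')
  refine antitoneOn_of_deriv_nonpos (convex_Ioi 0)
    (fun x hx => (hd x hx).continuousAt.continuousWithinAt)
    (fun x hx => (hd x (interior_subset hx)).differentiableAt.differentiableWithinAt)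
    fun x hx => ?_
  have hx0 : 0 < x := interior_subset hx
  rw [(hd x hx0).deriv]
  refine div_nonpos_of_nonpos_of_nonneg ?_ (by positivity)
  have := mul_le_mul_of_nonneg_left (eval_geomPoly_mul_derivative_two_le n hx0.le)
    (eval_geomPoly_nonneg n hx0.le)
  norm_num
  linarith

lemma eval_derivative_geomPoly_mul_pow_le (n : ℕ) {x y : ℝ} (hy : 0 ≤ y) (hxy : y ≤ x) :
    (geomPoly (n + 2)).derivative.eval x * y ^ n ≤
      (geomPoly (n + 2)).derivative.eval y * x ^ n := by
  induction n with
  | zero => simp [geomPoly, sum_range_succ]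
  | succ n ih =>
    have hx := hy.trans hxy
    rw [show n + 1 + 2 = n + 2 + 1 from rfl, geomPoly_succ (n + 2)]
    simp only [derivative_add, derivative_X_pow, eval_add, eval_mul, eval_C, eval_pow, eval_X,
      Nat.add_succ_sub_one]
    have h1 := mul_le_mul_of_nonneg_right ih hy
    have h2 := mul_le_mul_of_nonneg_left hxy
      (mul_nonneg (eval_derivative_geomPoly_nonneg (n + 2) hy) (pow_nonneg hx n))
    rw [pow_succ y, pow_succ x]
    linarith

lemma eval_geomPoly_sq_div_pow_le (n : ℕ) {x y : ℝ} (hy : 0 < y) (hxy : y ≤ x) :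
    (x * (geomPoly (n + 2)).derivative.eval x / (geomPoly (n + 2)).eval x) ^ 2 / x ^ (n + 2) ≤
      (y * (geomPoly (n + 2)).derivative.eval y / (geomPoly (n + 2)).eval y) ^ 2 /
        y ^ (n + 2) := by
  have hx := hy.trans_le hxy
  have h1 := antitoneOn_derivative_div_geomPoly_sq (n := n + 2) (by omega) hy hx hxy
  have h2 : (geomPoly (n + 2)).derivative.eval x / x ^ n ≤
      (geomPoly (n + 2)).derivative.eval y / y ^ n := by
    rw [div_le_div_iff₀ (by positivity) (by positivity)]
    exact eval_derivative_geomPoly_mul_pow_le n hy.le hxy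
  have key : ∀ t : ℝ, 0 < t →
      (t * (geomPoly (n + 2)).derivative.eval t / (geomPoly (n + 2)).eval t) ^ 2 / t ^ (n + 2) =
        (geomPoly (n + 2)).derivative.eval t / (geomPoly (n + 2)).eval t ^ 2 *
          ((geomPoly (n + 2)).derivative.eval t / t ^ n) := fun t ht => by
    have := (eval_geomPoly_pos (n := n + 2) (by omega) ht.le).ne'
    field_simp
    ring
  rw [key x hx, key y hy]
  exact mul_le_mul h1 h2
    (div_nonneg (eval_derivative_geomPoly_nonneg _ hx.le) (by positivity))
    (div_nonneg (eval_derivative_geomPoly_nonneg _ hy.le) (by positivity))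

end geomPoly

lemma rpow_two_div_pow {N : ℕ} (hN : N ≠ 0) {t : ℝ} (ht : 0 ≤ t) :
    (t ^ ((2 : ℝ) / N)) ^ N = t ^ 2 := by
  rw [← rpow_natCast (t ^ ((2 : ℝ) / N)), ← rpow_mul ht,
    div_mul_cancel₀ _ (Nat.cast_ne_zero.2 hN), rpow_two]

lemma rN_eq {N : ℕ} (hN : 1 ≤ N) {a b : ℝ} (ha : 0 < a) (hb : 0 < b) :
    rN N a b = (a / b) ^ ((2 : ℝ) / N) *
      (geomPoly N).derivative.eval ((a / b) ^ ((2 : ℝ) / N)) /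
        (geomPoly N).eval ((a / b) ^ ((2 : ℝ) / N)) / (N * a) := by
  have hN0 : (N : ℝ) ≠ 0 := by positivity
  unfold rN
  split_ifs with hab
  · subst hab
    rw [div_self ha.ne', one_rpow, eval_geomPoly_one, eval_derivative_geomPoly_one]
    field_simp
  · have hx0 : 0 < (a / b) ^ ((2 : ℝ) / N) := by positivity
    have hB : 0 < b ^ ((2 : ℝ) / N) := by positivity
    have hxN := rpow_two_div_pow (N := N) (by omega) (div_pos ha hb).le
    have hA : a ^ ((2 : ℝ) / N) = (a / b) ^ ((2 : ℝ) / N) * b ^ ((2 : ℝ) / N) := by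
      rw [← mul_rpow (by positivity) hb.le, div_mul_cancel₀ _ hb.ne']
    rw [rpow_sub_one ha.ne', hA]
    generalize (a / b) ^ ((2 : ℝ) / N) = x at *
    generalize b ^ ((2 : ℝ) / N) = B at *
    have hg := eval_geomPoly_pos hN hx0.le
    have h1 := congrArg (Polynomial.eval x) (geomPoly_mul_X_sub_one N)
    have h2 := congrArg (fun p => Polynomial.eval x (Polynomial.derivative p))
      (geomPoly_mul_X_sub_one N)
    simp only [Polynomial.derivative_mul, Polynomial.derivative_sub, Polynomial.derivative_X_pow,
      Polynomial.derivative_X, Polynomial.derivative_one, Polynomial.eval_mul,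
      Polynomial.eval_add, Polynomial.eval_sub, Polynomial.eval_X, Polynomial.eval_one,
      Polynomial.eval_pow, Polynomial.eval_C, sub_zero, mul_one] at h1 h2
    have ha2 : a ^ 2 = x ^ N * b ^ 2 := by rw [hxN]; field_simp
    have hne : x ^ N - 1 ≠ 0 := fun h => hab <| by
      rw [sub_eq_zero.1 h, one_mul] at ha2
      exact (pow_left_inj₀ ha.le hb.le two_ne_zero).1 ha2
    have hx1 : x - 1 ≠ 0 := fun h => hne (by rw [← h1, h, mul_zero])
    have e1 : a / (a ^ 2 - b ^ 2) = x ^ N / (a * (x ^ N - 1)) := by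
      have : a ^ 2 - b ^ 2 = (x ^ N - 1) * b ^ 2 := by rw [ha2]; ring
      rw [this, div_eq_div_iff (by positivity) (by positivity)]
      linear_combination (x ^ N - 1) * ha2
    have e2 : x * B / a / (N * (x * B - B)) = x / (a * N * (x - 1)) := by
      have : x * B - B = B * (x - 1) := by ring
      rw [this]
      field_simp
    have h3 : (N : ℝ) * x ^ N = x * (N * x ^ (N - 1)) := by
      conv_lhs => rw [← Nat.sub_add_cancel hN, pow_succ, Nat.sub_add_cancel hN]
      ring
    rw [← h2] at h3
    rw [e1, e2, ← h1]
    generalize (geomPoly N).derivative.eval x = g' at *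
    generalize (geomPoly N).eval x = g at *
    have := hg.ne'
    field_simp
    linear_combination h3

lemma rN_nonneg {N : ℕ} (hN : 1 ≤ N) {a b : ℝ} (ha : 0 < a) (hb : 0 < b) : 0 ≤ rN N a b := by
  have hx : 0 ≤ (a / b) ^ ((2 : ℝ) / N) := by positivity
  rw [rN_eq hN ha hb]
  exact div_nonneg (div_nonneg (mul_nonneg hx (eval_derivative_geomPoly_nonneg N hx))
    (eval_geomPoly_nonneg N hx)) (by positivity)

lemma rN_le_rN_left {N : ℕ} (hN : 2 ≤ N) {a b c : ℝ} (hb : 0 < b) (hc : 0 < c) (hab : b ≤ a) :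
    rN N a c ≤ rN N b c := by
  have ha := hb.trans_le hab
  refine le_of_sq_le_sq ?_ (rN_nonneg (by omega) hb hc)
  have key : ∀ t : ℝ, 0 < t → rN N t c ^ 2 = ((t / c) ^ ((2 : ℝ) / N) *
      (geomPoly N).derivative.eval ((t / c) ^ ((2 : ℝ) / N)) /
        (geomPoly N).eval ((t / c) ^ ((2 : ℝ) / N))) ^ 2 /
          ((t / c) ^ ((2 : ℝ) / N)) ^ N / (N * c) ^ 2 := fun t ht => by
    rw [rN_eq (by omega) ht hc, div_pow _ ((N : ℝ) * t),
      rpow_two_div_pow (by omega) (by positivity)]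
    field_simp
  rw [key a ha, key b hb]
  obtain ⟨n, rfl⟩ := Nat.exists_eq_add_of_le' hN
  gcongr ?_ / _
  exact eval_geomPoly_sq_div_pow_le n (by positivity)
    (rpow_le_rpow (by positivity) (by gcongr) (by positivity))

/-- The homogeneous form of `n sinh v ≤ sinh (n v)`. -/
lemma mul_pow_mul_sq_sub_le (n : ℕ) {z w : ℝ} (hw : 0 ≤ w) (hwz : w ≤ z) :
    (n + 1) * (z * w) ^ n * (z ^ 2 - w ^ 2) ≤ (z ^ 2) ^ (n + 1) - (w ^ 2) ^ (n + 1) := by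
  have hz := hw.trans hwz
  induction n with
  | zero => simp
  | succ n ih =>
    have h1 := mul_le_mul_of_nonneg_right ih (mul_nonneg hz hw)
    have h2 : 0 ≤ ((z ^ 2) ^ (n + 1) - (w ^ 2) ^ (n + 1)) * (z - w) ^ 2 :=
      mul_nonneg (sub_nonneg.2 (by gcongr)) (sq_nonneg _)
    have h3 : 0 ≤ (z ^ (n + 1) - w ^ (n + 1)) ^ 2 * (z ^ 2 - w ^ 2) :=
      mul_nonneg (sq_nonneg _) (sub_nonneg.2 (by gcongr))
    push_cast
    simp only [← pow_mul, mul_pow] at *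
    ring_nf at *
    linarith

lemma rN_le_rN_swap {N : ℕ} (hN : 2 ≤ N) {a b : ℝ} (hb : 0 < b) (hab : b < a) :
    rN N a b ≤ rN N b a := by
  have ha := hb.trans hab
  obtain ⟨n, rfl⟩ := Nat.exists_eq_add_of_le' hN
  have hroot : ∀ t : ℝ, 0 < t → ∃ z : ℝ, 0 < z ∧ z ^ (n + 2) = t ∧
      t ^ ((2 : ℝ) / (n + 2 : ℕ)) = z ^ 2 := fun t ht => by
    refine ⟨t ^ ((1 : ℝ) / (n + 2 : ℕ)), by positivity, ?_, ?_⟩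
    · rw [← rpow_natCast, ← rpow_mul ht.le, div_mul_cancel₀ _ (by positivity), rpow_one]
    · rw [← rpow_natCast, ← rpow_mul ht.le]
      congr 1
      push_cast
      ring
  obtain ⟨z, hz, hza, hz2⟩ := hroot a ha
  obtain ⟨w, hw, hwb, hw2⟩ := hroot b hb
  have hwz : w < z := lt_of_pow_lt_pow_left₀ (n + 2) hz.le (by rwa [hza, hwb])
  have hsq : 0 < z ^ 2 - w ^ 2 := sub_pos.2 (by gcongr)
  have hab' : 0 < a - b := sub_pos.2 hab
  have hsinh := mul_pow_mul_sq_sub_le n hw.le hwz.le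
  unfold rN
  rw [if_neg hab.ne', if_neg hab.ne, rpow_sub_one ha.ne', rpow_sub_one hb.ne', hz2, hw2]
  have e1 : a / (a ^ 2 - b ^ 2) - b / (b ^ 2 - a ^ 2) = 1 / (a - b) := by
    have h1 : a ^ 2 - b ^ 2 = (a - b) * (a + b) := by ring
    have h2 : b ^ 2 - a ^ 2 = -((a - b) * (a + b)) := by ring
    rw [h1, h2]
    field_simp
    ring
  have e2 : z ^ 2 / a / ((n + 2 : ℕ) * (z ^ 2 - w ^ 2)) -
      w ^ 2 / b / ((n + 2 : ℕ) * (w ^ 2 - z ^ 2)) =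
        (z ^ 2 * b + w ^ 2 * a) / (a * b * ((n + 2 : ℕ) * (z ^ 2 - w ^ 2))) := by
    have h2 : w ^ 2 - z ^ 2 = -(z ^ 2 - w ^ 2) := by ring
    rw [h2]
    field_simp
    ring
  have e3 : 1 / (a - b) ≤
      (z ^ 2 * b + w ^ 2 * a) / (a * b * ((n + 2 : ℕ) * (z ^ 2 - w ^ 2))) := by
    rw [div_le_div_iff₀ hab' (by positivity)]
    have h := mul_le_mul_of_nonneg_left hsinh (by positivity : 0 ≤ z ^ 2 * w ^ 2)
    rw [← hza, ← hwb]
    push_cast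
    simp only [← pow_mul, mul_pow] at *
    ring_nf at *
    linarith
  linarith

/-- Any ordered critical point of the free energy has all singular values equal,
and the common value satisfies the balance equation
`g'(d f(σ⋆)) f'(σ⋆) = β⁻¹ ((d−1)/(2σ⋆)) (1 − 1/N)`. -/
theorem stmt15 (N d : ℕ) (hN : 2 ≤ N) (hd : 2 ≤ d) (β : ℝ) (hβ : 0 < β)
    (g g' f f' : ℝ → ℝ)
    (hg : ∀ x, HasDerivAt g (g' x) x) (hg' : ∀ x, 0 < g' x)
    (hf : ∀ x, 0 < x → HasDerivAt f (f' x) x)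
    (hfconv : StrictConvexOn ℝ (Set.Ioi 0) f)
    (σ : Fin d → ℝ) (hpos : ∀ i, 0 < σ i)
    (hord : ∀ i j : Fin d, i ≤ j → σ j ≤ σ i)
    (hstat : ∀ i, g' (∑ k, f (σ k)) * f' (σ i) =
      β⁻¹ * ∑ k ∈ Finset.univ.erase i, rN N (σ i) (σ k)) :
    ∃ s : ℝ, 0 < s ∧ (∀ i, σ i = s) ∧
      g' ((d:ℝ) * f s) * f' s = β⁻¹ * (((d:ℝ)-1)/(2*s)) * (1 - 1/(N:ℝ)) := by
  have hslope : ∀ a b : ℝ, 0 < b → b < a → f' b < f' a := fun a b hb hab => by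
    have ha := hb.trans hab
    have h1 := hfconv.lt_slope_of_hasDerivAt hb ha hab (hf b hb)
    have h2 := hfconv.slope_lt_of_hasDerivAt hb ha hab (hf a ha)
    exact h1.trans h2
  have hno : ∀ i j, ¬ σ j < σ i := fun i j hlt => by
    have hij : i ≠ j := fun h => hlt.ne (by rw [h])
    have hL := mul_lt_mul_of_pos_left (hslope _ _ (hpos j) hlt) (hg' (∑ k, f (σ k)))
    rw [hstat i, hstat j] at hL
    have hS := lt_of_mul_lt_mul_left hL (inv_pos.2 hβ).le
    rw [← add_sum_erase _ _ (mem_erase.2 ⟨hij, mem_univ i⟩ : i ∈ univ.erase j),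
      ← add_sum_erase _ _ (mem_erase.2 ⟨hij.symm, mem_univ j⟩ : j ∈ univ.erase i),
      erase_right_comm] at hS
    exact hS.not_ge (add_le_add (rN_le_rN_swap hN (hpos j) hlt)
      (sum_le_sum fun k _ => rN_le_rN_left hN (hpos j) (hpos k) hlt.le))
  have heq : ∀ i, σ i = σ ⟨0, by omega⟩ := fun i =>
    le_antisymm (not_lt.1 (hno _ _)) (not_lt.1 (hno _ _))
  refine ⟨σ ⟨0, by omega⟩, hpos _, heq, ?_⟩
  have h := hstat ⟨0, by omega⟩
  simp only [heq, rN, if_true, sum_const, card_univ, Fintype.card_fin, nsmul_eq_mul,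
    card_erase_of_mem (mem_univ _)] at h
  rw [h, Nat.cast_sub (by omega), Nat.cast_one]
  ring
end

section
/- Let N ≥ 2, d ≥ 2 be integers with (N, d) ≠ (2, 2), let β > 0, let g : ℝ → ℝ be convex and nondecreasing, and let f : (0,∞) → ℝ be convex. Then the free energy F_β(σ) = g(Σ_{i=1}^d f(σ_i)) − β⁻¹ S_N(σ) is strictly convex on the convex set S_d = {σ ∈ ℝ^d : σ_1 ≥ σ_2 ≥ ⋯ ≥ σ_d > 0}. -/
open Real Finset

/-- `Φ_N(a,b) = Σ_{m=0}^{N-1} a^{2(N-1-m)} b^{2m}`. -/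
noncomputable def Phi (N : ℕ) (a b : ℝ) : ℝ :=
  ∑ m ∈ Finset.range N, a ^ (2 * (N - 1 - m)) * b ^ (2 * m)

/-- The DLN entropy `S_N(σ) = c + (1/2) Σ_{j<k} log Φ_N(σ_j^{1/N}, σ_k^{1/N})`. -/
noncomputable def Sent (N d : ℕ) (c : ℝ) (σ : Fin d → ℝ) : ℝ :=
  c + (1/2) * ∑ p ∈ Finset.univ.filter (fun p : Fin d × Fin d => p.1 < p.2),
    Real.log (Phi N (σ p.1 ^ ((1:ℝ)/N)) (σ p.2 ^ ((1:ℝ)/N)))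

/-- The chamber `S_d = {σ ∈ ℝ^d : σ_1 ≥ σ_2 ≥ ⋯ ≥ σ_d > 0}`. -/
def chamber (d : ℕ) : Set (Fin d → ℝ) :=
  {σ | (∀ i, 0 < σ i) ∧ ∀ i j : Fin d, i ≤ j → σ j ≤ σ i}

/-- Pointwise step: `u ↦ u ^ (-q)` is log-convex, combined with weighted AM-GM. -/
theorem rpow_neg_weighted_le {q s r A B x y : ℝ} (hq : 0 ≤ q) (hs : 0 < s) (hr : 0 < r)
    (hsr : s + r = 1) (hA : 0 < A) (hB : 0 < B) (hx : 0 < x) (hy : 0 < y) :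
    (s * x + r * y) ^ (-q) ≤ A ^ s * B ^ r * (s * (x ^ (-q) / A) + r * (y ^ (-q) / B)) ∧
      (0 < q → x ≠ y →
        (s * x + r * y) ^ (-q) < A ^ s * B ^ r * (s * (x ^ (-q) / A) + r * (y ^ (-q) / B))) := by
  have hxy : 0 < x ^ s * y ^ r := by positivity
  have hgm : x ^ s * y ^ r ≤ s * x + r * y :=
    Real.geom_mean_le_arith_mean2_weighted hs.le hr.le hx.le hy.le hsr
  have hamgm := Real.geom_mean_le_arith_mean2_weighted hs.le hr.le
    (by positivity : 0 ≤ x ^ (-q) / A) (by positivity : 0 ≤ y ^ (-q) / B) hsr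
  have hle : (x ^ s * y ^ r) ^ (-q) ≤
      A ^ s * B ^ r * (s * (x ^ (-q) / A) + r * (y ^ (-q) / B)) := by
    have h : (x ^ s * y ^ r) ^ (-q) =
        A ^ s * B ^ r * ((x ^ (-q) / A) ^ s * (y ^ (-q) / B) ^ r) := by
      rw [Real.div_rpow (by positivity) hA.le, Real.div_rpow (by positivity) hB.le,
        Real.mul_rpow (by positivity) (by positivity), ← Real.rpow_mul hx.le,
        ← Real.rpow_mul hy.le, ← Real.rpow_mul hx.le, ← Real.rpow_mul hy.le,
        mul_comm s, mul_comm r]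
      have h1 : A ^ s ≠ 0 := by positivity
      have h2 : B ^ r ≠ 0 := by positivity
      field_simp
    rw [h]
    gcongr
  refine ⟨(Real.rpow_le_rpow_of_nonpos hxy hgm (by linarith)).trans hle, fun hq0 hne => ?_⟩
  have hlt : x ^ s * y ^ r < s * x + r * y := by
    have h := strictConcaveOn_log_Ioi.2 (Set.mem_Ioi.2 hx) (Set.mem_Ioi.2 hy) hne hs hr hsr
    simp only [smul_eq_mul] at h
    rw [← Real.log_lt_log_iff hxy (by positivity), Real.log_mul (by positivity) (by positivity),
      Real.log_rpow hx, Real.log_rpow hy]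
    exact h
  exact (Real.rpow_lt_rpow_of_neg hxy hlt (by linarith)).trans_le hle

/-- The average of `u ^ (-q)` over the segment from `b` to `a`. -/
noncomputable def segMean (q a b : ℝ) : ℝ := ∫ t in (0 : ℝ)..1, (t * a + (1 - t) * b) ^ (-q)

theorem segment_pos {a b t : ℝ} (ha : 0 < a) (hb : 0 < b) (ht : t ∈ Set.Icc (0 : ℝ) 1) :
    0 < t * a + (1 - t) * b := by
  rcases ht.1.eq_or_lt with rfl | h
  · simpa using hb
  · have := mul_pos h ha
    have := mul_nonneg (sub_nonneg.2 ht.2) hb.le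
    linarith

theorem continuousOn_segment_rpow {a b : ℝ} (q : ℝ) (ha : 0 < a) (hb : 0 < b) :
    ContinuousOn (fun t : ℝ => (t * a + (1 - t) * b) ^ (-q)) (Set.Icc 0 1) := by
  refine ContinuousOn.rpow_const (by fun_prop) fun t ht => Or.inl (segment_pos ha hb ht).ne'

theorem intervalIntegrable_segment_rpow {a b : ℝ} (q : ℝ) (ha : 0 < a) (hb : 0 < b) :
    IntervalIntegrable (fun t : ℝ => (t * a + (1 - t) * b) ^ (-q)) MeasureTheory.volume 0 1 :=
  (Set.uIcc_of_le (zero_le_one' ℝ) ▸ continuousOn_segment_rpow q ha hb).intervalIntegrable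

theorem segMean_pos {a b : ℝ} (q : ℝ) (ha : 0 < a) (hb : 0 < b) : 0 < segMean q a b :=
  intervalIntegral.intervalIntegral_pos_of_pos_on (intervalIntegrable_segment_rpow q ha hb)
    (fun _ ht => Real.rpow_pos_of_pos (segment_pos ha hb (Set.Ioo_subset_Icc_self ht)) _)
    zero_lt_one

/-- `segMean q` is log-convex on the open quadrant, strictly when `0 < q`. -/
theorem segMean_logConvex {q s r a b a' b' : ℝ} (hq : 0 ≤ q) (hs : 0 < s) (hr : 0 < r)
    (hsr : s + r = 1) (ha : 0 < a) (hb : 0 < b) (ha' : 0 < a') (hb' : 0 < b') :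
    segMean q (s * a + r * a') (s * b + r * b') ≤ segMean q a b ^ s * segMean q a' b' ^ r ∧
      (0 < q → a ≠ a' ∨ b ≠ b' →
        segMean q (s * a + r * a') (s * b + r * b') <
          segMean q a b ^ s * segMean q a' b' ^ r) := by
  have hA := segMean_pos q ha hb
  have hB := segMean_pos q ha' hb'
  set A := segMean q a b with hAdef
  set B := segMean q a' b' with hBdef
  have hma : 0 < s * a + r * a' := by positivity
  have hmb : 0 < s * b + r * b' := by positivity
  have hpt := fun (t : ℝ) (ht : t ∈ Set.Icc (0 : ℝ) 1) =>
    rpow_neg_weighted_le hq hs hr hsr hA hB (segment_pos ha hb ht) (segment_pos ha' hb' ht)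
  have hlin : ∀ t : ℝ, t * (s * a + r * a') + (1 - t) * (s * b + r * b') =
      s * (t * a + (1 - t) * b) + r * (t * a' + (1 - t) * b') := fun t => by ring
  have hi := intervalIntegrable_segment_rpow q ha hb
  have hi' := intervalIntegrable_segment_rpow q ha' hb'
  have hint : ∫ t in (0 : ℝ)..1, A ^ s * B ^ r * (s * ((t * a + (1 - t) * b) ^ (-q) / A) +
      r * ((t * a' + (1 - t) * b') ^ (-q) / B)) = A ^ s * B ^ r := by
    rw [intervalIntegral.integral_const_mul, intervalIntegral.integral_add
      ((hi.div_const A).const_mul s) ((hi'.div_const B).const_mul r),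
      intervalIntegral.integral_const_mul, intervalIntegral.integral_const_mul,
      intervalIntegral.integral_div, intervalIntegral.integral_div]
    change A ^ s * B ^ r * (s * (A / A) + r * (B / B)) = _
    rw [div_self hA.ne', div_self hB.ne', mul_one, mul_one, hsr, mul_one]
  have hc := continuousOn_segment_rpow q ha hb
  have hc' := continuousOn_segment_rpow q ha' hb'
  have hcm := continuousOn_segment_rpow q hma hmb
  have hcR : ContinuousOn (fun t : ℝ => A ^ s * B ^ r * (s * ((t * a + (1 - t) * b) ^ (-q) / A) +
      r * ((t * a' + (1 - t) * b') ^ (-q) / B))) (Set.Icc 0 1) :=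
    (((hc.div_const A).const_mul s).add ((hc'.div_const B).const_mul r)).const_mul _
  have hcRi := (Set.uIcc_of_le (zero_le_one' ℝ) ▸ hcR :
    ContinuousOn _ (Set.uIcc (0 : ℝ) 1)).intervalIntegrable (μ := MeasureTheory.volume)
  rw [← hint, segMean]
  refine ⟨intervalIntegral.integral_mono_on zero_le_one
    (intervalIntegrable_segment_rpow q hma hmb) hcRi fun t ht => ?_, fun hq0 hne => ?_⟩
  · rw [hlin]
    exact (hpt t ht).1
  · refine intervalIntegral.integral_lt_integral_of_continuousOn_of_le_of_exists_lt zero_lt_one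
      hcm hcR (fun t ht => ?_) ?_
    · rw [hlin]
      exact (hpt t (Set.Ioc_subset_Icc_self ht)).1
    · rcases hne with h | h
      · refine ⟨1, by simp, ?_⟩
        rw [hlin]
        exact (hpt 1 (by simp)).2 hq0 (by simpa using h)
      · refine ⟨0, by simp, ?_⟩
        rw [hlin]
        exact (hpt 0 (by simp)).2 hq0 (by simpa using h)

theorem mul_segMean_mul_sub {p a b : ℝ} (ha : 0 < a) (hb : 0 < b) :
    p * segMean (1 - p) a b * (a - b) = a ^ p - b ^ p := by
  have hderiv : ∀ t ∈ Set.uIcc (0 : ℝ) 1, HasDerivAt (fun t : ℝ => (t * a + (1 - t) * b) ^ p)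
      (p * (a - b) * (t * a + (1 - t) * b) ^ (-(1 - p))) t := fun t ht => by
    rw [Set.uIcc_of_le zero_le_one] at ht
    have h : HasDerivAt (fun t : ℝ => t * a + (1 - t) * b) (a - b) t := by
      have h1 := ((hasDerivAt_id t).mul_const a).add
        (((hasDerivAt_id t).const_sub 1).mul_const b)
      exact h1.congr_deriv (by ring)
    refine (h.rpow_const (Or.inl (segment_pos ha hb ht).ne')).congr_deriv ?_
    rw [neg_sub]
    ring
  have h := intervalIntegral.integral_eq_sub_of_hasDerivAt hderiv
    ((intervalIntegrable_segment_rpow (1 - p) ha hb).const_mul _)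
  rw [intervalIntegral.integral_const_mul] at h
  simp only [one_mul, sub_self, zero_mul, add_zero, sub_zero, zero_add] at h
  rw [← h, segMean]
  ring

theorem Phi_pos {N : ℕ} (hN : 0 < N) {a b : ℝ} (ha : 0 < a) (hb : 0 < b) : 0 < Phi N a b :=
  Finset.sum_pos (fun _ _ => by positivity) ⟨0, Finset.mem_range.2 hN⟩

theorem Phi_mul_sub (N : ℕ) (a b : ℝ) :
    Phi N a b * (a ^ 2 - b ^ 2) = (a ^ N) ^ 2 - (b ^ N) ^ 2 := by
  have h := (Commute.all (b ^ 2) (a ^ 2)).geom_sum₂_mul N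
  have hP : Phi N a b = ∑ i ∈ Finset.range N, (b ^ 2) ^ i * (a ^ 2) ^ (N - 1 - i) :=
    Finset.sum_congr rfl fun i _ => by rw [pow_mul, pow_mul, mul_comm]
  rw [hP, pow_right_comm a, pow_right_comm b]
  linarith

theorem Phi_self {N : ℕ} (a : ℝ) : Phi N a a = N * (a ^ 2) ^ (N - 1) := by
  rw [Phi, Finset.sum_congr rfl (g := fun _ => (a ^ 2) ^ (N - 1)), Finset.sum_const,
    Finset.card_range, nsmul_eq_mul]
  intro m hm
  have := Finset.mem_range.1 hm
  rw [← pow_add, ← pow_mul]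
  congr 1
  omega

theorem Phi_mul_segMean {N : ℕ} (hN : 0 < N) {a b : ℝ} (ha : 0 < a) (hb : 0 < b) :
    Phi N (a ^ ((1 : ℝ) / N)) (b ^ ((1 : ℝ) / N)) * (2 / N * segMean (1 - 2 / N) a b) =
      a + b := by
  have hN0 : (N : ℝ) ≠ 0 := by positivity
  have hpow : ∀ {u : ℝ}, 0 < u → (u ^ ((1 : ℝ) / N)) ^ N = u := fun hu => by
    rw [← Real.rpow_natCast, ← Real.rpow_mul hu.le, one_div_mul_cancel hN0, Real.rpow_one]
  have hsq : ∀ {u : ℝ}, 0 < u → (u ^ ((1 : ℝ) / N)) ^ 2 = u ^ ((2 : ℝ) / N) := fun hu => by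
    rw [← Real.rpow_natCast, ← Real.rpow_mul hu.le]
    congr 1
    push_cast
    ring
  rcases eq_or_ne a b with rfl | hab
  · have hseg : segMean (1 - 2 / N) a a = a ^ (2 / N - 1 : ℝ) := by
      have : ∀ t : ℝ, t * a + (1 - t) * a = a := fun t => by ring
      simp [segMean, this]
    rw [Phi_self, hseg, hsq ha, ← Real.rpow_natCast, ← Real.rpow_mul ha.le]
    calc _ = (N : ℝ) * (2 / N) * (a ^ (2 / N * ((N - 1 : ℕ) : ℝ)) * a ^ (2 / N - 1 : ℝ)) := by
          ring
      _ = 2 * a ^ (1 : ℝ) := by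
          rw [← Real.rpow_add ha, mul_div_cancel₀ _ hN0]
          congr 2
          rw [Nat.cast_sub hN]
          field_simp
          push_cast
          ring
      _ = a + a := by rw [Real.rpow_one, two_mul]
  · have h1 := Phi_mul_sub N (a ^ ((1 : ℝ) / N)) (b ^ ((1 : ℝ) / N))
    rw [hpow ha, hpow hb, hsq ha, hsq hb, ← mul_segMean_mul_sub ha hb] at h1
    refine mul_right_cancel₀ (sub_ne_zero.2 hab) ?_
    linear_combination h1

theorem log_Phi_eq {N : ℕ} (hN : 0 < N) {a b : ℝ} (ha : 0 < a) (hb : 0 < b) :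
    Real.log (Phi N (a ^ ((1 : ℝ) / N)) (b ^ ((1 : ℝ) / N))) =
      Real.log (a + b) - Real.log (segMean (1 - 2 / N) a b) - Real.log (2 / N) := by
  have hP := Phi_pos hN (Real.rpow_pos_of_pos ha ((1 : ℝ) / N))
    (Real.rpow_pos_of_pos hb ((1 : ℝ) / N))
  have hS := segMean_pos (1 - 2 / N) ha hb
  have hN0 : (2 / N : ℝ) ≠ 0 := by positivity
  rw [← Phi_mul_segMean hN ha hb, Real.log_mul hP.ne' (by positivity),
    Real.log_mul hN0 hS.ne']
  ring

/-- Concavity of a single pair term of the entropy, with its strictness cases. -/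
theorem log_Phi_concave {N : ℕ} (hN : 2 ≤ N) {s r a b a' b' : ℝ} (hs : 0 < s) (hr : 0 < r)
    (hsr : s + r = 1) (ha : 0 < a) (hb : 0 < b) (ha' : 0 < a') (hb' : 0 < b') :
    s * Real.log (Phi N (a ^ ((1 : ℝ) / N)) (b ^ ((1 : ℝ) / N))) +
        r * Real.log (Phi N (a' ^ ((1 : ℝ) / N)) (b' ^ ((1 : ℝ) / N))) ≤
      Real.log (Phi N ((s * a + r * a') ^ ((1 : ℝ) / N)) ((s * b + r * b') ^ ((1 : ℝ) / N))) ∧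
    ((a + b ≠ a' + b' ∨ 2 < N ∧ (a ≠ a' ∨ b ≠ b')) →
      s * Real.log (Phi N (a ^ ((1 : ℝ) / N)) (b ^ ((1 : ℝ) / N))) +
        r * Real.log (Phi N (a' ^ ((1 : ℝ) / N)) (b' ^ ((1 : ℝ) / N))) <
      Real.log (Phi N ((s * a + r * a') ^ ((1 : ℝ) / N))
        ((s * b + r * b') ^ ((1 : ℝ) / N)))) := by
  have hN0 : 0 < N := by omega
  have hNR : (0 : ℝ) < N := by exact_mod_cast hN0
  have hma : 0 < s * a + r * a' := by positivity
  have hmb : 0 < s * b + r * b' := by positivity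
  have hq : (0 : ℝ) ≤ 1 - 2 / N := by
    rw [sub_nonneg, div_le_one hNR]
    exact_mod_cast hN
  have hab : 0 < a + b := by positivity
  have hab' : 0 < a' + b' := by positivity
  have hJ := segMean_pos (1 - 2 / N) ha hb
  have hJ' := segMean_pos (1 - 2 / N) ha' hb'
  have hJm := segMean_pos (1 - 2 / N) hma hmb
  have hlogmul : Real.log (segMean (1 - 2 / N) a b ^ s * segMean (1 - 2 / N) a' b' ^ r) =
      s * Real.log (segMean (1 - 2 / N) a b) + r * Real.log (segMean (1 - 2 / N) a' b') := by
    rw [Real.log_mul (by positivity) (by positivity), Real.log_rpow hJ, Real.log_rpow hJ']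
  have hconv := segMean_logConvex hq hs hr hsr ha hb ha' hb'
  have hJle := Real.log_le_log hJm hconv.1
  rw [hlogmul] at hJle
  have hsum : s * a + r * a' + (s * b + r * b') = s * (a + b) + r * (a' + b') := by ring
  have hlog := strictConcaveOn_log_Ioi.concaveOn.2 (Set.mem_Ioi.2 hab) (Set.mem_Ioi.2 hab')
    hs.le hr.le hsr
  simp only [smul_eq_mul] at hlog
  have hconst : s * Real.log (2 / N) + r * Real.log (2 / N) = Real.log (2 / N) := by
    rw [← add_mul, hsr, one_mul]
  rw [log_Phi_eq hN0 ha hb, log_Phi_eq hN0 ha' hb', log_Phi_eq hN0 hma hmb, hsum]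
  refine ⟨by linarith, ?_⟩
  rintro (hne | ⟨hN2, hne⟩)
  · have hlt := strictConcaveOn_log_Ioi.2 (Set.mem_Ioi.2 hab) (Set.mem_Ioi.2 hab') hne hs hr hsr
    simp only [smul_eq_mul] at hlt
    linarith
  · have hq0 : (0 : ℝ) < 1 - 2 / N := by
      rw [sub_pos, div_lt_one hNR]
      exact_mod_cast hN2
    have hlt := Real.log_lt_log hJm (hconv.2 hq0 hne)
    rw [hlogmul] at hlt
    linarith

/-- The pairwise sums of a vector of length at least three determine the vector. -/
theorem exists_lt_add_ne {d : ℕ} (hd : 3 ≤ d) {x y : Fin d → ℝ} (hxy : x ≠ y) :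
    ∃ j k : Fin d, j < k ∧ x j + x k ≠ y j + y k := by
  by_contra! h
  have hsum : ∀ j k : Fin d, j ≠ k → x j + x k = y j + y k := fun j k hjk => by
    rcases hjk.lt_or_gt with h' | h'
    · exact h j k h'
    · linarith [h k j h']
  refine hxy (funext fun i => ?_)
  obtain ⟨j, hj⟩ : ∃ j, j ∉ ({i} : Finset (Fin d)) :=
    Finset.exists_mem_notMem_of_card_lt_card (t := Finset.univ) (by simp; omega)
      |>.imp fun _ h => h.2
  obtain ⟨k, hk⟩ : ∃ k, k ∉ ({i, j} : Finset (Fin d)) :=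
    Finset.exists_mem_notMem_of_card_lt_card (t := Finset.univ)
      (Finset.card_le_two.trans_lt (by simp; omega)) |>.imp fun _ h => h.2
  simp only [Finset.mem_singleton, Finset.mem_insert, not_or] at hj hk
  linarith [hsum i j (Ne.symm hj), hsum i k (Ne.symm hk.1), hsum j k (Ne.symm hk.2)]

theorem exists_lt_ne {d : ℕ} (hd : 2 ≤ d) {x y : Fin d → ℝ} (hxy : x ≠ y) :
    ∃ j k : Fin d, j < k ∧ (x j ≠ y j ∨ x k ≠ y k) := by
  obtain ⟨i, hi⟩ := Function.ne_iff.1 hxy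
  have : Nontrivial (Fin d) := Fin.nontrivial_iff_two_le.2 hd
  obtain ⟨j, hj⟩ := exists_ne i
  rcases hj.lt_or_gt with h | h
  · exact ⟨j, i, h, Or.inr hi⟩
  · exact ⟨i, j, h, Or.inl hi⟩

theorem convex_chamber (d : ℕ) : Convex ℝ (chamber d) := by
  intro x hx y hy s r hs hr hsr
  refine ⟨fun i => ?_, fun i j hij => ?_⟩
  · exact (convex_Ioi (0 : ℝ)) (hx.1 i) (hy.1 i) hs hr hsr
  · simp only [Pi.add_apply, Pi.smul_apply, smul_eq_mul]
    have := hx.2 i j hij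
    have := hy.2 i j hij
    gcongr

/-- Strict concavity of the entropy on the open orthant. -/
theorem Sent_strictConcave {N d : ℕ} (hN : 2 ≤ N) (hd : 2 ≤ d) (hNd : ¬(N = 2 ∧ d = 2))
    (c : ℝ) {x y : Fin d → ℝ} (hx : ∀ i, 0 < x i) (hy : ∀ i, 0 < y i) (hxy : x ≠ y)
    {s r : ℝ} (hs : 0 < s) (hr : 0 < r) (hsr : s + r = 1) :
    s * Sent N d c x + r * Sent N d c y < Sent N d c (s • x + r • y) := by
  have hpair := fun p : Fin d × Fin d =>
    log_Phi_concave hN hs hr hsr (hx p.1) (hx p.2) (hy p.1) (hy p.2)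
  obtain ⟨j, k, hjk, hne⟩ : ∃ j k : Fin d, j < k ∧
      (x j + x k ≠ y j + y k ∨ 2 < N ∧ (x j ≠ y j ∨ x k ≠ y k)) := by
    rcases hN.eq_or_lt with h | h
    · obtain ⟨j, k, hjk, hne⟩ := exists_lt_add_ne (by omega) hxy
      exact ⟨j, k, hjk, Or.inl hne⟩
    · obtain ⟨j, k, hjk, hne⟩ := exists_lt_ne hd hxy
      exact ⟨j, k, hjk, Or.inr ⟨h, hne⟩⟩
  have hlt := Finset.sum_lt_sum
    (s := Finset.univ.filter fun p : Fin d × Fin d => p.1 < p.2)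
    (fun p _ => (hpair p).1) ⟨(j, k), by simpa using hjk, (hpair (j, k)).2 hne⟩
  rw [Finset.sum_add_distrib, ← Finset.mul_sum, ← Finset.mul_sum] at hlt
  have hc : s * c + r * c = c := by rw [← add_mul, hsr, one_mul]
  simp only [Sent, Pi.add_apply, Pi.smul_apply, smul_eq_mul]
  linarith

theorem comp_sum_convex {d : ℕ} {g f : ℝ → ℝ} (hg : ConvexOn ℝ Set.univ g)
    (hgmono : Monotone g) (hf : ConvexOn ℝ (Set.Ioi 0) f) {x y : Fin d → ℝ}
    (hx : ∀ i, 0 < x i) (hy : ∀ i, 0 < y i) {s r : ℝ} (hs : 0 ≤ s) (hr : 0 ≤ r)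
    (hsr : s + r = 1) :
    g (∑ i, f ((s • x + r • y) i)) ≤ s * g (∑ i, f (x i)) + r * g (∑ i, f (y i)) := by
  have hsum : ∑ i, f ((s • x + r • y) i) ≤ s * ∑ i, f (x i) + r * ∑ i, f (y i) := by
    rw [Finset.mul_sum, Finset.mul_sum, ← Finset.sum_add_distrib]
    exact Finset.sum_le_sum fun i _ => hf.2 (hx i) (hy i) hs hr hsr
  exact (hgmono hsum).trans (hg.2 trivial trivial hs hr hsr)

/-- For `(N,d) ≠ (2,2)`, `β > 0`, `g` convex nondecreasing and `f` convex on
`(0,∞)`, the free energy `F_β(σ) = g(Σ_i f(σ_i)) − β⁻¹ S_N(σ)` is strictly convex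
on the chamber `S_d`. -/
theorem stmt18 (N d : ℕ) (hN : 2 ≤ N) (hd : 2 ≤ d) (hNd : ¬(N = 2 ∧ d = 2))
    (c : ℝ) (β : ℝ) (hβ : 0 < β) (g f : ℝ → ℝ)
    (hg : ConvexOn ℝ Set.univ g) (hgmono : Monotone g)
    (hf : ConvexOn ℝ (Set.Ioi 0) f) :
    StrictConvexOn ℝ (chamber d)
      (fun σ => g (∑ i, f (σ i)) - β⁻¹ * Sent N d c σ) := by
  refine ⟨convex_chamber d, fun x hx y hy hxy s r hs hr hsr => ?_⟩
  have hS := mul_lt_mul_of_pos_left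
    (Sent_strictConcave hN hd hNd c hx.1 hy.1 hxy hs hr hsr) (inv_pos.2 hβ)
  have hG := comp_sum_convex hg hgmono hf hx.1 hy.1 hs.le hr.le hsr
  simp only [smul_eq_mul]
  linarith
end
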